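/- Let G be a connected graph with at least one odd-degree vertex. A trail cover C of G is maximal if and only if: (1) C is a subset of some minimum trail decomposition of G, (2) every vertex of odd degree in the covered subgraph G(C) has the same degree in G(C) as in G, and (3) the complement subgraph G \ G(C) (edges of G not covered by C) is acyclic. -/

import Mathlib

/-- A trail in a simple graph: a walk with no repeated edges, together with its endpoints. -/
structure GraphTrail {V : Type*} (G : SimpleGraph V) where
  first : V
  last : V
  walk : G.Walk first last
  isTrail : walk.IsTrail

namespace GraphTrail

variable {V : Type*} {G : SimpleGraph V}

/-- The list of edges traversed by the trail. -/
def edges (T : GraphTrail G) : List (Sym2 V) := T.walk.edges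

/-- The list of vertices visited by the trail (with multiplicity). -/
def support (T : GraphTrail G) : List V := T.walk.support

end GraphTrail

/-- A collection of trails is edge-disjoint if no two distinct trails share an edge. -/
def TrailsEdgeDisjoint {V : Type*} {G : SimpleGraph V} (C : Finset (GraphTrail G)) : Prop :=
  (C : Set (GraphTrail G)).Pairwise fun T₁ T₂ => ∀ e, e ∈ T₁.edges → e ∉ T₂.edges

/-- A trail cover of `G`: a set of pairwise edge-disjoint trails visiting every vertex. -/
def IsTrailCover {V : Type*} (G : SimpleGraph V) (C : Finset (GraphTrail G)) : Prop :=
  TrailsEdgeDisjoint C ∧ ∀ v : V, ∃ T ∈ C, v ∈ T.support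

/-- A trail decomposition of `G`: a set of pairwise edge-disjoint trails covering every edge. -/
def IsTrailDecomposition {V : Type*} (G : SimpleGraph V) (C : Finset (GraphTrail G)) : Prop :=
  TrailsEdgeDisjoint C ∧ ∀ e ∈ G.edgeSet, ∃ T ∈ C, e ∈ T.edges

/-- The set of edges of `G` traversed by some trail of `C`. -/
def coveredEdges {V : Type*} {G : SimpleGraph V} (C : Finset (GraphTrail G)) : Set (Sym2 V) :=
  {e | ∃ T ∈ C, e ∈ T.edges}

/-- The subgraph `G(C)` of `G` covered by the trails of `C` (as a simple graph on `V`). -/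
def coveredGraph {V : Type*} {G : SimpleGraph V} (C : Finset (GraphTrail G)) : SimpleGraph V :=
  SimpleGraph.fromEdgeSet (coveredEdges C)

/-- A trail cover `C` of `G` is maximal if `C` is a minimum trail decomposition of the covered
subgraph `G(C)`, and every trail cover covering strictly more edges has strictly more trails. -/
def IsMaximalTrailCover {V : Type*} (G : SimpleGraph V) (C : Finset (GraphTrail G)) : Prop :=
  IsTrailCover G C ∧
  (∀ D : Finset (GraphTrail (coveredGraph C)),
      IsTrailDecomposition (coveredGraph C) D → C.card ≤ D.card) ∧
  (∀ C' : Finset (GraphTrail G), IsTrailCover G C' →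
      coveredEdges C ⊂ coveredEdges C' → C.card < C'.card)

/-- A minimum trail decomposition: one with the fewest trails. -/
def IsMinTrailDecomposition {V : Type*} (G : SimpleGraph V) (D : Finset (GraphTrail G)) : Prop :=
  IsTrailDecomposition G D ∧
    ∀ D' : Finset (GraphTrail G), IsTrailDecomposition G D' → D.card ≤ D'.card

namespace TrailCover

open SimpleGraph

variable {V : Type*} {G : SimpleGraph V}

/-- The number of edges of `S` incident to `v`. -/
noncomputable def edgeDegree (S : Set (Sym2 V)) (v : V) : ℕ := {e | e ∈ S ∧ v ∈ e}.ncard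

open Classical in
/-- The number of ends of the trail `T` located at `v`. -/
noncomputable def endCount (T : GraphTrail G) (v : V) : ℕ :=
  (if T.first = v then 1 else 0) + (if T.last = v then 1 else 0)

open Classical in
/-- The vertices incident to an odd number of edges of `S`. -/
noncomputable def oddVertices [Fintype V] (S : Set (Sym2 V)) : Finset V :=
  Finset.univ.filter fun v => Odd (edgeDegree S v)

/-- No edge-disjoint family with the same covered edges has fewer trails. -/
def IsCheapest (C : Finset (GraphTrail G)) : Prop :=
  ∀ C' : Finset (GraphTrail G), TrailsEdgeDisjoint C' → coveredEdges C' = coveredEdges C →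
    C.card ≤ C'.card

lemma mem_oddVertices [Fintype V] {S : Set (Sym2 V)} {v : V} :
    v ∈ oddVertices S ↔ Odd (edgeDegree S v) := by
  simp [oddVertices]

lemma ncard_neighborSet (H : SimpleGraph V) (v : V) :
    (H.neighborSet v).ncard = edgeDegree H.edgeSet v := by
  have hinj : Function.Injective fun w : V => s(v, w) := fun _ _ h => Sym2.congr_right.1 h
  rw [edgeDegree, ← Set.ncard_image_of_injective _ hinj]
  congr 1
  ext e
  constructor
  · rintro ⟨w, hw, rfl⟩
    exact ⟨hw, Sym2.mem_mk_left _ _⟩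
  · rintro ⟨he, w, rfl⟩
    exact ⟨w, he, rfl⟩

lemma coveredEdges_subset (C : Finset (GraphTrail G)) : coveredEdges C ⊆ G.edgeSet := by
  rintro e ⟨T, -, he⟩
  exact T.walk.edges_subset_edgeSet he

lemma edgeSet_coveredGraph (C : Finset (GraphTrail G)) :
    (coveredGraph C).edgeSet = coveredEdges C := by
  ext e
  simp only [coveredGraph, edgeSet_fromEdgeSet, Set.mem_sdiff, and_iff_left_iff_imp]
  exact fun he => G.not_isDiag_of_mem_edgeSet (coveredEdges_subset C he)

lemma isTrailDecomposition_iff {D : Finset (GraphTrail G)} :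
    IsTrailDecomposition G D ↔ TrailsEdgeDisjoint D ∧ coveredEdges D = G.edgeSet :=
  and_congr_right fun _ =>
    ⟨fun h => (coveredEdges_subset D).antisymm h, fun h _ he => h.ge he⟩

lemma edgeDegree_union [Finite V] {S S' : Set (Sym2 V)} (h : Disjoint S S') (v : V) :
    edgeDegree (S ∪ S') v = edgeDegree S v + edgeDegree S' v := by
  rw [edgeDegree, edgeDegree, edgeDegree, ← Set.ncard_union_eq _ (Set.toFinite _) (Set.toFinite _)]
  · congr 1
    ext e
    simp [or_and_right]
  · exact h.mono (fun _ he => he.1) (fun _ he => he.1)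

lemma odd_edgeDegree_trail (T : GraphTrail G) (v : V) :
    Odd (edgeDegree {e | e ∈ T.edges} v) ↔ Odd (endCount T v) := by
  classical
  have h : edgeDegree {e | e ∈ T.edges} v = T.walk.edges.countP fun e => v ∈ e := by
    rw [List.countP_eq_length_filter,
      ← List.toFinset_card_of_nodup (T.isTrail.edges_nodup.filter _), ← Set.ncard_coe_finset,
      edgeDegree]
    congr 1
    ext e
    simp [GraphTrail.edges]
  rw [h, ← Nat.not_even_iff_odd, T.isTrail.even_countP_edges_iff, endCount]
  split_ifs <;> grind

lemma TrailsEdgeDisjoint.mono {C D : Finset (GraphTrail G)} (hD : TrailsEdgeDisjoint D)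
    (h : C ⊆ D) : TrailsEdgeDisjoint C :=
  Set.Pairwise.mono (by exact_mod_cast h) hD

lemma odd_edgeDegree_coveredEdges [Finite V] {C : Finset (GraphTrail G)}
    (hC : TrailsEdgeDisjoint C) (v : V) :
    Odd (edgeDegree (coveredEdges C) v) ↔ Odd (∑ T ∈ C, endCount T v) := by
  classical
  induction C using Finset.induction_on with
  | empty => simp [edgeDegree, coveredEdges]
  | insert T C hT ih =>
    have hcov : coveredEdges (insert T C) = {e | e ∈ T.edges} ∪ coveredEdges C := by
      ext e
      simp [coveredEdges]
    have hdis : Disjoint {e | e ∈ T.edges} (coveredEdges C) := by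
      rw [Set.disjoint_left]
      rintro e he ⟨T', hT', he'⟩
      exact hC (by simp) (by simp [hT']) (by grind) e he he'
    rw [hcov, edgeDegree_union hdis, Finset.sum_insert hT, Nat.odd_add', Nat.odd_add',
      ih (hC.mono (Finset.subset_insert _ _)), ← Nat.not_odd_iff_even, odd_edgeDegree_trail,
      Nat.not_odd_iff_even]

lemma sum_endCount [Fintype V] (C : Finset (GraphTrail G)) :
    ∑ v, ∑ T ∈ C, endCount T v = 2 * C.card := by
  rw [Finset.sum_comm]
  have h : ∀ T ∈ C, ∑ v, endCount T v = 2 := fun T _ => by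
    classical
    simp [endCount, Finset.sum_add_distrib, Finset.sum_ite_eq]
  rw [Finset.sum_congr rfl h]
  simp [mul_comm]

lemma card_oddVertices_eq_sum [Fintype V] (S : Set (Sym2 V)) :
    (oddVertices S).card = ∑ v, (edgeDegree S v) % 2 := by
  rw [oddVertices, Finset.card_filter]
  refine Finset.sum_congr rfl fun v _ => ?_
  split_ifs with h
  · exact (Nat.odd_iff.1 h).symm
  · exact (Nat.even_iff.1 (Nat.not_odd_iff_even.1 h)).symm

lemma edgeDegree_mod_two [Finite V] {C : Finset (GraphTrail G)} (hC : TrailsEdgeDisjoint C)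
    (v : V) : edgeDegree (coveredEdges C) v % 2 = (∑ T ∈ C, endCount T v) % 2 := by
  have := odd_edgeDegree_coveredEdges hC v
  rw [Nat.odd_iff, Nat.odd_iff] at this
  omega

lemma card_oddVertices_le [Fintype V] {C : Finset (GraphTrail G)} (hC : TrailsEdgeDisjoint C) :
    (oddVertices (coveredEdges C)).card ≤ 2 * C.card := by
  rw [card_oddVertices_eq_sum, ← sum_endCount]
  refine Finset.sum_le_sum fun v _ => ?_
  rw [edgeDegree_mod_two hC]
  exact Nat.mod_le _ _

lemma card_oddVertices_eq_iff [Fintype V] {C : Finset (GraphTrail G)}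
    (hC : TrailsEdgeDisjoint C) :
    (oddVertices (coveredEdges C)).card = 2 * C.card ↔ ∀ v, ∑ T ∈ C, endCount T v ≤ 1 := by
  rw [card_oddVertices_eq_sum, ← sum_endCount]
  simp_rw [edgeDegree_mod_two hC]
  rw [Finset.sum_eq_sum_iff_of_le fun v _ => Nat.mod_le _ _]
  constructor
  · intro h v
    have := h v (Finset.mem_univ v)
    omega
  · intro h v _
    have := h v
    omega

open Classical in
lemma disjoint_insert_sdiff {C S : Finset (GraphTrail G)} (hC : TrailsEdgeDisjoint C) (hS : S ⊆ C)
    {T : GraphTrail G} (hT : ∀ e ∈ T.edges, e ∈ coveredEdges S ∨ e ∉ coveredEdges C) :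
    TrailsEdgeDisjoint (insert T (C \ S)) := by
  have key : ∀ T' ∈ C \ S, ∀ e ∈ T.edges, e ∉ T'.edges := by
    intro T' hT' e he he'
    rw [Finset.mem_sdiff] at hT'
    rcases hT e he with ⟨T₁, hT₁, h₁⟩ | h
    · exact hC (hS hT₁) hT'.1 (fun h => hT'.2 (h ▸ hT₁)) e h₁ he'
    · exact h ⟨T', hT'.1, he'⟩
  intro T₁ h₁ T₂ h₂ hne
  rw [Finset.mem_coe, Finset.mem_insert] at h₁ h₂
  rcases h₁ with rfl | h₁ <;> rcases h₂ with rfl | h₂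
  · exact absurd rfl hne
  · exact key T₂ h₂
  · exact fun e h h' => key T₁ h₁ e h' h
  · exact hC (Finset.mem_sdiff.1 h₁).1 (Finset.mem_sdiff.1 h₂).1 hne

open Classical in
lemma coveredEdges_insert_sdiff {C S : Finset (GraphTrail G)} {T : GraphTrail G}
    (hT : ∀ e ∈ coveredEdges S, e ∈ T.edges) :
    coveredEdges (insert T (C \ S)) = {e | e ∈ T.edges} ∪ coveredEdges C := by
  ext e
  constructor
  · rintro ⟨T', hT', he⟩
    rcases Finset.mem_insert.1 hT' with rfl | h
    · exact Or.inl he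
    · exact Or.inr ⟨T', (Finset.mem_sdiff.1 h).1, he⟩
  · rintro (he | ⟨T', hT', he⟩)
    · exact ⟨T, by simp, he⟩
    · by_cases h : T' ∈ S
      · exact ⟨T, by simp, hT e ⟨T', h, he⟩⟩
      · exact ⟨T', by simp [hT', h], he⟩

lemma exists_disjoint_family [Finite V] {S : Set (Sym2 V)} (hS : S ⊆ G.edgeSet) :
    ∃ C : Finset (GraphTrail G), TrailsEdgeDisjoint C ∧ coveredEdges C = S := by
  classical
  induction S, S.toFinite using Set.Finite.induction_on with
  | empty => exact ⟨∅, by simp [TrailsEdgeDisjoint], by simp [coveredEdges]⟩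
  | @insert e S he _ ih =>
    obtain ⟨C, hC, hcov⟩ := ih ((Set.subset_insert _ _).trans hS)
    have he' : e ∈ G.edgeSet := hS (Set.mem_insert _ _)
    induction e using Sym2.ind with
    | _ x y =>
      have hadj : G.Adj x y := he'
      let T : GraphTrail G := ⟨x, y, .cons hadj .nil, by simp [Walk.isTrail_def]⟩
      have hT : ∀ e, e ∈ T.edges ↔ e = s(x, y) := by simp [T, GraphTrail.edges]
      refine ⟨insert T (C \ ∅), disjoint_insert_sdiff hC (by simp) ?_, ?_⟩
      · intro e h
        rw [(hT e).1 h, hcov]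
        exact Or.inr he
      · rw [coveredEdges_insert_sdiff (by simp [coveredEdges]), hcov]
        ext e
        simp [hT]

lemma exists_cheapest [Finite V] {S : Set (Sym2 V)} (hS : S ⊆ G.edgeSet) :
    ∃ C : Finset (GraphTrail G), TrailsEdgeDisjoint C ∧ coveredEdges C = S ∧ IsCheapest C := by
  classical
  have hex : ∃ n, ∃ C : Finset (GraphTrail G),
      (TrailsEdgeDisjoint C ∧ coveredEdges C = S) ∧ C.card = n := by
    obtain ⟨C, hC⟩ := exists_disjoint_family hS
    exact ⟨_, C, hC, rfl⟩
  obtain ⟨C, hC, hcard⟩ := Nat.find_spec hex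
  refine ⟨C, hC.1, hC.2, fun C' hC' hcov => ?_⟩
  rw [hcard]
  exact Nat.find_min' hex ⟨C', ⟨hC', hcov.trans hC.2⟩, rfl⟩

lemma isTrail_transfer {H : SimpleGraph V} {u v : V} {p : G.Walk u v} (hp : p.IsTrail)
    (h : ∀ e ∈ p.edges, e ∈ H.edgeSet) : (p.transfer H h).IsTrail := by
  rw [Walk.isTrail_def, Walk.edges_transfer]
  exact hp.edges_nodup

lemma exists_splice {T : GraphTrail G} {x : V} (hx : x ∈ T.support) (q : G.Walk x x)
    (hq : q.IsTrail) (hd : ∀ e ∈ q.edges, e ∉ T.edges) :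
    ∃ T' : GraphTrail G, (∀ e, e ∈ T'.edges ↔ e ∈ T.edges ∨ e ∈ q.edges) ∧
      ∀ w ∈ T.support, w ∈ T'.support := by
  obtain ⟨a, b, p, hp⟩ := T
  simp only [GraphTrail.edges, GraphTrail.support] at *
  obtain ⟨p₁, p₂, rfl⟩ := Walk.mem_support_iff_exists_append.1 hx
  refine ⟨⟨a, b, p₁.append (q.append p₂), ?_⟩, ?_, ?_⟩
  · simp only [Walk.isTrail_def, Walk.edges_append, List.nodup_append', List.disjoint_left,
      List.mem_append] at *
    grind
  · intro e
    simp only [Walk.edges_append, List.mem_append]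
    tauto
  · intro w
    simp only [Walk.mem_support_append_iff]
    tauto

lemma exists_walk_from_end {T : GraphTrail G} {v : V} (h : endCount T v ≠ 0) :
    ∃ (w : V) (p : G.Walk v w), p.IsTrail ∧ (∀ e, e ∈ p.edges ↔ e ∈ T.edges) ∧
      ∀ x, x ∈ p.support ↔ x ∈ T.support := by
  by_cases h₁ : T.first = v
  · subst h₁
    exact ⟨_, T.walk, T.isTrail, fun _ => Iff.rfl, fun _ => Iff.rfl⟩
  · by_cases h₂ : T.last = v
    · subst h₂
      exact ⟨_, T.walk.reverse, Walk.IsTrail.reverse _ T.isTrail, by simp [GraphTrail.edges],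
        by simp [GraphTrail.support]⟩
    · simp [endCount, h₁, h₂] at h

lemma exists_walk_of_closed {T : GraphTrail G} (h : T.first = T.last) {v : V}
    (hv : v ∈ T.support) :
    ∃ p : G.Walk v v, p.IsTrail ∧ (∀ e, e ∈ p.edges ↔ e ∈ T.edges) ∧
      ∀ x, x ∈ p.support ↔ x ∈ T.support := by
  classical
  obtain ⟨a, b, p, hp⟩ := T
  obtain rfl : a = b := h
  exact ⟨p.rotate v hv, hp.rotate hv, fun e => (p.rotate_edges v hv).perm.mem_iff,
    fun x => p.mem_support_rotate_iff v hv⟩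

/-- Two trails of a cheapest family cannot be merged into a single one. -/
lemma IsCheapest.not_mergeable {C : Finset (GraphTrail G)} (hmin : IsCheapest C)
    (hC : TrailsEdgeDisjoint C) {T₁ T₂ : GraphTrail G} (h₁ : T₁ ∈ C) (h₂ : T₂ ∈ C) (hne : T₁ ≠ T₂)
    {T : GraphTrail G} (hT : ∀ e, e ∈ T.edges ↔ e ∈ T₁.edges ∨ e ∈ T₂.edges) : False := by
  classical
  have hS : ({T₁, T₂} : Finset (GraphTrail G)) ⊆ C := by
    simp [Finset.insert_subset_iff, h₁, h₂]
  have hcov : ∀ e, e ∈ coveredEdges {T₁, T₂} ↔ e ∈ T.edges := by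
    intro e
    simp [coveredEdges, hT]
  have hle := hmin (insert T (C \ {T₁, T₂}))
    (disjoint_insert_sdiff hC hS fun e he => Or.inl ((hcov e).2 he)) (by
      rw [coveredEdges_insert_sdiff fun e he => (hcov e).1 he, Set.union_eq_right]
      intro e he
      obtain ⟨T', hT', he'⟩ := (hcov e).2 he
      exact ⟨T', hS hT', he'⟩)
  have hlt := Finset.card_insert_le T (C \ {T₁, T₂})
  have hsub := Finset.card_sdiff_add_card_eq_card hS
  rw [Finset.card_pair hne] at hsub
  omega

lemma IsCheapest.edges_ne_nil {C : Finset (GraphTrail G)} (hmin : IsCheapest C)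
    (hC : TrailsEdgeDisjoint C) {T : GraphTrail G} (hT : T ∈ C) : T.edges ≠ [] := by
  classical
  intro hnil
  have hle := hmin (C.erase T) (hC.mono (Finset.erase_subset _ _)) (by
    ext e
    constructor
    · rintro ⟨T', hT', he⟩
      exact ⟨T', Finset.mem_of_mem_erase hT', he⟩
    · rintro ⟨T', hT', he⟩
      refine ⟨T', Finset.mem_erase.2 ⟨?_, hT'⟩, he⟩
      rintro rfl
      simp [hnil] at he)
  exact absurd hle (Finset.card_erase_lt_of_mem hT).not_ge

lemma IsCheapest.sum_endCount_le_one {C : Finset (GraphTrail G)} (hmin : IsCheapest C)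
    (hC : TrailsEdgeDisjoint C) (hopen : ∀ T ∈ C, T.first ≠ T.last) (v : V) :
    ∑ T ∈ C, endCount T v ≤ 1 := by
  by_cases h : ∃ T ∈ C, endCount T v ≠ 0
  · obtain ⟨T, hT, hTv⟩ := h
    rw [Finset.sum_eq_single_of_mem T hT]
    · have := hopen T hT
      rw [endCount]
      split_ifs <;> grind
    · intro T' hT' hne
      by_contra hTv'
      obtain ⟨w, p, hp, hpe, -⟩ := exists_walk_from_end hTv
      obtain ⟨w', p', hp', hpe', -⟩ := exists_walk_from_end hTv'
      refine hmin.not_mergeable hC hT hT' hne.symm (T := ⟨w, w', p.reverse.append p', ?_⟩) ?_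
      · rw [Walk.isTrail_append]
        refine ⟨hp.reverse, hp', ?_⟩
        intro e he he'
        rw [Walk.edges_reverse, List.mem_reverse, hpe] at he
        exact hC hT hT' hne.symm e he ((hpe' e).1 he')
      · intro e
        simp [GraphTrail.edges, hpe, hpe']
  · push Not at h
    rw [Finset.sum_eq_zero h]
    exact zero_le_one

lemma IsCheapest.first_ne_last [Finite V] (hconn : G.Connected) {u : V}
    (hu : Odd (edgeDegree G.edgeSet u)) {C : Finset (GraphTrail G)} (hmin : IsCheapest C)
    (hC : TrailsEdgeDisjoint C) {T : GraphTrail G} (hT : T ∈ C)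
    (hcov : T.first = T.last → ∀ x ∈ T.support, ∀ y, G.Adj x y → s(x, y) ∈ coveredEdges C) :
    T.first ≠ T.last := by
  intro hclosed
  have hedge : ∀ x ∈ T.support, ∀ y, G.Adj x y → s(x, y) ∈ T.edges := by
    intro x hx y hxy
    obtain ⟨T', hT', he⟩ := hcov hclosed x hx y hxy
    by_cases hne : T = T'
    · exact hne ▸ he
    · exfalso
      obtain ⟨q, hq, hqe, -⟩ := exists_walk_of_closed hclosed hx
      have hx' : x ∈ T'.support := T'.walk.fst_mem_support_of_mem_edges he
      obtain ⟨T'', hT'', -⟩ := exists_splice hx' q hq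
        fun e he => hC hT hT' hne e ((hqe e).1 he)
      exact hmin.not_mergeable hC hT' hT (Ne.symm hne) (T := T'') fun e => by
        rw [hT'', hqe]
  have hsupp : ∀ x, x ∈ T.support := by
    intro x
    obtain ⟨p⟩ := hconn T.first x
    have key : ∀ {a b : V} (p : G.Walk a b), a ∈ T.support → b ∈ T.support := by
      intro a b p
      induction p with
      | nil => exact id
      | cons h p ih =>
        exact fun ha => ih (T.walk.snd_mem_support_of_mem_edges (hedge _ ha _ h))
    exact key p T.walk.start_mem_support
  have hset : G.edgeSet = {e | e ∈ T.edges} := by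
    ext e
    refine ⟨fun he => ?_, fun he => T.walk.edges_subset_edgeSet he⟩
    induction e using Sym2.ind with
    | _ x y => exact hedge x (hsupp x) y he
  rw [hset, odd_edgeDegree_trail, endCount, hclosed] at hu
  split_ifs at hu <;> simp [Nat.odd_iff] at hu

/-- An edge set containing no nonempty closed trail decomposes into half as many trails as it has
odd vertices. -/
lemma exists_family_of_acyclic [Fintype V] {S : Set (Sym2 V)} (hS : S ⊆ G.edgeSet)
    (hac : (fromEdgeSet S).IsAcyclic) :
    ∃ D : Finset (GraphTrail G), TrailsEdgeDisjoint D ∧ coveredEdges D = S ∧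
      (oddVertices S).card = 2 * D.card := by
  obtain ⟨D, hD, hcov, hmin⟩ := exists_cheapest hS
  refine ⟨D, hD, hcov, ?_⟩
  rw [← hcov, card_oddVertices_eq_iff hD]
  refine hmin.sum_endCount_le_one hD fun T hT hclosed => hmin.edges_ne_nil hD hT ?_
  obtain ⟨p, hp, hpe, -⟩ := exists_walk_of_closed hclosed T.walk.start_mem_support
  have hmem : ∀ e ∈ p.edges, e ∈ (fromEdgeSet S).edgeSet := by
    intro e he
    rw [← hcov, edgeSet_fromEdgeSet]
    exact ⟨⟨T, hT, (hpe e).1 he⟩, G.not_isDiag_of_mem_edgeSet (p.edges_subset_edgeSet he)⟩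
  have hpath := (hac.isPath_iff_isTrail (p.transfer _ hmem)).2 (isTrail_transfer hp hmem)
  have hnil : p.edges = [] := by
    rw [← p.edges_transfer hmem, Walk.edges_eq_nil]
    exact Walk.isPath_iff_nil.1 hpath
  rw [List.eq_nil_iff_forall_not_mem]
  intro e he
  rw [← hpe, hnil] at he
  simp at he

lemma _root_.IsMaximalTrailCover.isCheapest {C : Finset (GraphTrail G)}
    (h : IsMaximalTrailCover G C) : IsCheapest C := by
  classical
  intro C' hC' hcov
  have hmem : ∀ T ∈ C', ∀ e ∈ T.walk.edges, e ∈ (coveredGraph C).edgeSet := by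
    intro T hT e he
    rw [edgeSet_coveredGraph, ← hcov]
    exact ⟨T, hT, he⟩
  let f : {T // T ∈ C'} → GraphTrail (coveredGraph C) := fun T =>
    ⟨T.1.first, T.1.last, T.1.walk.transfer _ (hmem T.1 T.2),
      isTrail_transfer T.1.isTrail (hmem T.1 T.2)⟩
  have hf : ∀ T e, e ∈ (f T).edges ↔ e ∈ T.1.edges := by
    intro T e
    simp [f, GraphTrail.edges]
  have hle := h.2.1 (C'.attach.image f) (by
    refine ⟨?_, ?_⟩
    · intro T₁ h₁ T₂ h₂ hne e he he'
      obtain ⟨T₁, -, rfl⟩ := Finset.mem_image.1 h₁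
      obtain ⟨T₂, -, rfl⟩ := Finset.mem_image.1 h₂
      refine hC' T₁.2 T₂.2 (fun heq => hne ?_) e ((hf _ _).1 he) ((hf _ _).1 he')
      rw [Subtype.ext heq]
    · intro e he
      rw [edgeSet_coveredGraph, ← hcov] at he
      obtain ⟨T, hT, he⟩ := he
      exact ⟨f ⟨T, hT⟩, Finset.mem_image_of_mem _ (Finset.mem_attach _ _), (hf _ _).2 he⟩)
  exact hle.trans (Finset.card_image_le.trans Finset.card_attach.le)

/-- A trail of a maximal cover cannot be replaced by one traversing additional uncovered edges. -/
lemma _root_.IsMaximalTrailCover.mem_coveredEdges_of_extension {C : Finset (GraphTrail G)}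
    (h : IsMaximalTrailCover G C) {T T' : GraphTrail G} (hT : T ∈ C)
    (hsub : ∀ e ∈ T.edges, e ∈ T'.edges) (hsupp : ∀ w ∈ T.support, w ∈ T'.support)
    (hnew : ∀ e ∈ T'.edges, e ∈ T.edges ∨ e ∉ coveredEdges C) :
    ∀ e ∈ T'.edges, e ∈ coveredEdges C := by
  classical
  intro e he
  by_contra hnot
  have hcov : ∀ e, e ∈ coveredEdges {T} ↔ e ∈ T.edges := by
    intro e
    simp [coveredEdges]
  have hS : ({T} : Finset (GraphTrail G)) ⊆ C := Finset.singleton_subset_iff.2 hT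
  have hunion := coveredEdges_insert_sdiff (C := C) fun e he => hsub e ((hcov e).1 he)
  refine absurd (h.2.2 (insert T' (C \ {T})) ⟨?_, ?_⟩ ?_) ?_
  · exact disjoint_insert_sdiff h.1.1 hS fun e he => (hnew e he).imp_left (hcov e).2
  · intro v
    obtain ⟨T₁, h₁, hv⟩ := h.1.2 v
    by_cases hne : T₁ = T
    · exact ⟨T', by simp, hsupp v (hne ▸ hv)⟩
    · exact ⟨T₁, by simp [h₁, hne], hv⟩
  · rw [hunion]
    exact ⟨Set.subset_union_right, fun hle => hnot (hle (Or.inl he))⟩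
  · have hlt := Finset.card_insert_le T' (C \ {T})
    have hsub := Finset.card_sdiff_add_card_eq_card hS
    rw [Finset.card_singleton] at hsub
    omega

lemma _root_.IsMaximalTrailCover.mem_coveredEdges_of_adj {C : Finset (GraphTrail G)}
    (h : IsMaximalTrailCover G C) {T : GraphTrail G} (hT : T ∈ C) {v w : V} {p : G.Walk v w}
    (hp : p.IsTrail) (hpe : ∀ e, e ∈ p.edges ↔ e ∈ T.edges)
    (hps : ∀ x, x ∈ p.support ↔ x ∈ T.support) {y : V} (hvy : G.Adj v y) :
    s(v, y) ∈ coveredEdges C := by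
  by_contra hnot
  have hedges : ∀ e, e ∈ (Walk.cons hvy.symm p).edges ↔ e = s(v, y) ∨ e ∈ T.edges := by
    intro e
    rw [Walk.edges_cons, List.mem_cons, hpe, Sym2.eq_swap]
  have htrail : (Walk.cons hvy.symm p).IsTrail := by
    rw [Walk.isTrail_cons, Sym2.eq_swap, hpe]
    exact ⟨hp, fun he => hnot ⟨T, hT, he⟩⟩
  refine hnot (h.mem_coveredEdges_of_extension hT (T' := ⟨_, _, _, htrail⟩)
    (fun e he => (hedges e).2 (Or.inr he)) ?_ ?_ _ ((hedges _).2 (Or.inl rfl)))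
  · intro x hx
    exact List.mem_cons_of_mem _ ((hps x).2 hx)
  · intro e he
    rcases (hedges e).1 he with rfl | he
    · exact Or.inr hnot
    · exact Or.inl he

lemma _root_.IsMaximalTrailCover.edgeDegree_eq [Finite V] {C : Finset (GraphTrail G)}
    (h : IsMaximalTrailCover G C) {v : V} (hv : Odd (edgeDegree (coveredEdges C) v)) :
    edgeDegree (coveredEdges C) v = edgeDegree G.edgeSet v := by
  rw [odd_edgeDegree_coveredEdges h.1.1] at hv
  obtain ⟨T, hT, hTv⟩ := Finset.exists_ne_zero_of_sum_ne_zero hv.pos.ne'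
  obtain ⟨w, p, hp, hpe, hps⟩ := exists_walk_from_end hTv
  rw [edgeDegree, edgeDegree]
  congr 1
  ext e
  refine ⟨fun he => ⟨coveredEdges_subset C he.1, he.2⟩, ?_⟩
  rintro ⟨he, y, rfl⟩
  exact ⟨h.mem_coveredEdges_of_adj hT hp hpe hps he, Sym2.mem_mk_left _ _⟩

lemma _root_.IsMaximalTrailCover.isAcyclic {C : Finset (GraphTrail G)}
    (h : IsMaximalTrailCover G C) : (G.deleteEdges (coveredEdges C)).IsAcyclic := by
  intro v c hc
  have hle : G.deleteEdges (coveredEdges C) ≤ G := deleteEdges_le _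
  have hnot : ∀ e ∈ (c.mapLe hle).edges, e ∉ coveredEdges C := by
    intro e he
    rw [Walk.edges_mapLe_eq_edges] at he
    have := c.edges_subset_edgeSet he
    rw [edgeSet_deleteEdges] at this
    exact this.2
  obtain ⟨T, hT, hv⟩ := h.1.2 v
  obtain ⟨T', hT', hs⟩ := exists_splice hv (c.mapLe hle) (hc.isTrail.mapLe hle)
    fun e he heT => hnot e he ⟨T, hT, heT⟩
  have hcov := h.mem_coveredEdges_of_extension hT (fun e he => (hT' e).2 (Or.inl he)) hs
    fun e he => ((hT' e).1 he).imp_right (hnot e)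
  obtain ⟨e, he⟩ : ∃ e, e ∈ (c.mapLe hle).edges := by
    rw [Walk.edges_mapLe_eq_edges]
    exact List.exists_mem_of_ne_nil _ fun hnil => hc.not_nil (Walk.edges_eq_nil.1 hnil)
  exact hnot e he (hcov e ((hT' e).2 (Or.inr he)))

lemma card_oddVertices_union [Fintype V] {S S' : Set (Sym2 V)} (h : Disjoint S S')
    (hodd : ∀ v, Odd (edgeDegree S v) → edgeDegree S' v = 0) :
    (oddVertices (S ∪ S')).card = (oddVertices S).card + (oddVertices S').card := by
  simp_rw [card_oddVertices_eq_sum, ← Finset.sum_add_distrib, edgeDegree_union h]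
  refine Finset.sum_congr rfl fun v _ => ?_
  rcases Nat.even_or_odd (edgeDegree S v) with hv | hv
  · rw [Nat.even_iff] at hv
    omega
  · rw [hodd v hv]
    simp

lemma deleteEdges_eq_fromEdgeSet (S : Set (Sym2 V)) :
    G.deleteEdges S = fromEdgeSet (G.edgeSet \ S) := by
  rw [← edgeSet_inj, edgeSet_deleteEdges, edgeSet_fromEdgeSet]
  ext e
  exact ⟨fun he => ⟨he, G.not_isDiag_of_mem_edgeSet he.1⟩, fun he => he.1⟩

lemma edgeDegree_diff_eq_zero [Finite V] {S S' : Set (Sym2 V)} (h : S ⊆ S') {v : V}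
    (hv : edgeDegree S v = edgeDegree S' v) : edgeDegree (S' \ S) v = 0 := by
  have := edgeDegree_union (Set.disjoint_sdiff_right (s := S) (t := S')) v
  rw [Set.union_sdiff_cancel h] at this
  omega

lemma card_oddVertices_of_isMinTrailDecomposition [Fintype V] (hconn : G.Connected)
    (hodd : ∃ v, Odd (edgeDegree G.edgeSet v)) {D : Finset (GraphTrail G)}
    (hD : IsMinTrailDecomposition G D) : (oddVertices G.edgeSet).card = 2 * D.card := by
  obtain ⟨u, hu⟩ := hodd
  obtain ⟨hdis, hcov⟩ := isTrailDecomposition_iff.1 hD.1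
  have hmin : IsCheapest D := fun D' hD' hcov' =>
    hD.2 D' (isTrailDecomposition_iff.2 ⟨hD', hcov'.trans hcov⟩)
  rw [← hcov, card_oddVertices_eq_iff hdis]
  refine hmin.sum_endCount_le_one hdis fun T hT => hmin.first_ne_last hconn hu hdis hT ?_
  intro _ x _ y hxy
  rw [hcov]
  exact hxy

lemma _root_.IsMaximalTrailCover.card_oddVertices [Fintype V] (hconn : G.Connected)
    (hodd : ∃ v, Odd (edgeDegree G.edgeSet v)) {C : Finset (GraphTrail G)}
    (h : IsMaximalTrailCover G C) : (oddVertices (coveredEdges C)).card = 2 * C.card := by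
  obtain ⟨u, hu⟩ := hodd
  rw [card_oddVertices_eq_iff h.1.1]
  refine h.isCheapest.sum_endCount_le_one h.1.1 fun T hT =>
    h.isCheapest.first_ne_last hconn hu h.1.1 hT ?_
  intro hclosed x hx y hxy
  obtain ⟨p, hp, hpe, hps⟩ := exists_walk_of_closed hclosed hx
  exact h.mem_coveredEdges_of_adj hT hp hpe hps hxy

lemma _root_.IsMaximalTrailCover.exists_isMinTrailDecomposition [Fintype V] (hconn : G.Connected)
    (hodd : ∃ v, Odd (edgeDegree G.edgeSet v)) {C : Finset (GraphTrail G)}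
    (h : IsMaximalTrailCover G C) :
    ∃ D : Finset (GraphTrail G), IsMinTrailDecomposition G D ∧ C ⊆ D := by
  classical
  have hac := h.isAcyclic
  rw [deleteEdges_eq_fromEdgeSet] at hac
  obtain ⟨F, hF, hFcov, hFcard⟩ := exists_family_of_acyclic Set.sdiff_subset hac
  have hcov : coveredEdges (C ∪ F) = G.edgeSet := by
    rw [← Set.union_sdiff_cancel (coveredEdges_subset C), ← hFcov]
    ext e
    simp [coveredEdges, or_and_right, exists_or]
  have hcross : ∀ T ∈ C, ∀ T' ∈ F, ∀ e ∈ T.edges, e ∉ T'.edges := by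
    intro T hT T' hT' e he he'
    have : e ∈ coveredEdges F := ⟨T', hT', he'⟩
    rw [hFcov] at this
    exact this.2 ⟨T, hT, he⟩
  have hcard := card_oddVertices_union
    (Set.disjoint_sdiff_right (s := coveredEdges C) (t := G.edgeSet)) fun v hv =>
      edgeDegree_diff_eq_zero (coveredEdges_subset C) (h.edgeDegree_eq hv)
  rw [Set.union_sdiff_cancel (coveredEdges_subset C), hFcard,
    h.card_oddVertices hconn hodd] at hcard
  refine ⟨C ∪ F, ⟨isTrailDecomposition_iff.2 ⟨?_, hcov⟩, ?_⟩, Finset.subset_union_left⟩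
  · intro T₁ h₁ T₂ h₂ hne
    rw [Finset.mem_coe, Finset.mem_union] at h₁ h₂
    rcases h₁ with h₁ | h₁ <;> rcases h₂ with h₂ | h₂
    · exact h.1.1 h₁ h₂ hne
    · exact hcross T₁ h₁ T₂ h₂
    · exact fun e he he' => hcross T₂ h₂ T₁ h₁ e he' he
    · exact hF h₁ h₂ hne
  · intro D' hD'
    obtain ⟨hdis, hcov'⟩ := isTrailDecomposition_iff.1 hD'
    have hle := card_oddVertices_le hdis
    rw [hcov'] at hle
    have hunion := Finset.card_union_le C F
    omega

lemma isMaximalTrailCover_of_subset [Fintype V] (hconn : G.Connected)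
    (hodd : ∃ v, Odd (edgeDegree G.edgeSet v)) {C D : Finset (GraphTrail G)}
    (hC : IsTrailCover G C) (hD : IsMinTrailDecomposition G D) (hCD : C ⊆ D)
    (hdeg : ∀ v, Odd (edgeDegree (coveredEdges C) v) →
      edgeDegree (coveredEdges C) v = edgeDegree G.edgeSet v)
    (hac : (G.deleteEdges (coveredEdges C)).IsAcyclic) : IsMaximalTrailCover G C := by
  have hDcard := card_oddVertices_of_isMinTrailDecomposition hconn hodd hD
  obtain ⟨hdis, hcov⟩ := isTrailDecomposition_iff.1 hD.1
  rw [← hcov, card_oddVertices_eq_iff hdis] at hDcard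
  have hCcard := (card_oddVertices_eq_iff hC.1).2 fun v =>
    (Finset.sum_le_sum_of_subset hCD).trans (hDcard v)
  refine ⟨hC, fun E hE => ?_, fun C' hC' hss => ?_⟩
  · obtain ⟨hdis', hcov'⟩ := isTrailDecomposition_iff.1 hE
    have hle := card_oddVertices_le hdis'
    rw [hcov', edgeSet_coveredGraph] at hle
    omega
  · have hsub : coveredEdges C' \ coveredEdges C ⊆ G.edgeSet \ coveredEdges C :=
      Set.sdiff_subset_sdiff_left (coveredEdges_subset C')
    rw [deleteEdges_eq_fromEdgeSet] at hac
    obtain ⟨F, hF, hFcov, hFcard⟩ := exists_family_of_acyclic (hsub.trans Set.sdiff_subset)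
      (hac.anti (fromEdgeSet_mono hsub))
    have hcard := card_oddVertices_union
      (Set.disjoint_sdiff_right (s := coveredEdges C) (t := coveredEdges C')) fun v hv => by
        have hzero := edgeDegree_diff_eq_zero (coveredEdges_subset C) (hdeg v hv)
        rw [edgeDegree, Set.ncard_eq_zero] at hzero ⊢
        exact Set.subset_empty_iff.1 (hzero ▸ fun e he => ⟨hsub he.1, he.2⟩)
    rw [Set.union_sdiff_cancel hss.1, hFcard, hCcard] at hcard
    have hle := card_oddVertices_le hC'.1
    obtain ⟨e, he⟩ := Set.nonempty_of_ssubset hss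
    rw [← hFcov] at he
    obtain ⟨T, hT, -⟩ := he
    have hpos : 0 < F.card := Finset.card_pos.2 ⟨T, hT⟩
    omega

end TrailCover

/-- Let `G` be connected with at least one odd-degree vertex.  A trail cover
`C` of `G` is maximal iff (1) `C` is a subset of some minimum trail decomposition of `G`,
(2) every vertex of odd degree in `G(C)` has the same degree in `G(C)` as in `G`, and
(3) the uncovered part `G \ G(C)` is acyclic. -/
theorem maximal_trail_cover_characterization {V : Type*} [Fintype V] (G : SimpleGraph V)
    (hconn : G.Connected) (hodd : ∃ v, Odd ((G.neighborSet v).ncard))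
    (C : Finset (GraphTrail G)) (hC : IsTrailCover G C) :
    IsMaximalTrailCover G C ↔
      ((∃ D : Finset (GraphTrail G), IsMinTrailDecomposition G D ∧ C ⊆ D) ∧
        (∀ v : V, Odd (((coveredGraph C).neighborSet v).ncard) →
          ((coveredGraph C).neighborSet v).ncard = (G.neighborSet v).ncard) ∧
        (G.deleteEdges (coveredEdges C)).IsAcyclic) := by
  simp_rw [TrailCover.ncard_neighborSet, TrailCover.edgeSet_coveredGraph] at hodd ⊢
  constructor
  · intro h
    exact ⟨h.exists_isMinTrailDecomposition hconn hodd, fun v => h.edgeDegree_eq, h.isAcyclic⟩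
  · rintro ⟨⟨D, hD, hCD⟩, hdeg, hac⟩
    exact TrailCover.isMaximalTrailCover_of_subset hconn hodd hC hD hCD hdeg hac
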